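/- arXiv:1002.4529 — 2 statements merged into one kernel-verified Lean document; each statement's English description precedes it below -/
import Mathlib

section
/- For any finite set H of closed half-planes in ℝ², there exists a 2-coloring of H such that every point of ℝ² contained in at least three half-planes of H is contained in half-planes of both colors. -/
/-- A closed half-plane in `ℝ²`: the set of points on one side of a line. -/
def IsHalfPlane (h : Set (ℝ × ℝ)) : Prop :=
  ∃ a b c : ℝ, (a, b) ≠ (0, 0) ∧ h = {p : ℝ × ℝ | a * p.1 + b * p.2 ≤ c}

/-- The standard bilinear form on `ℝ²`. -/
def planeDot (a x : ℝ × ℝ) : ℝ := a.1 * x.1 + a.2 * x.2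

/-- The determinant of two plane vectors. -/
def planeCross (a b : ℝ × ℝ) : ℝ := a.1 * b.2 - a.2 * b.1

theorem planeDot_comb {a b c : ℝ × ℝ} {s t : ℝ} (h : a = s • b + t • c) (x : ℝ × ℝ) :
    planeDot a x = s * planeDot b x + t * planeDot c x := by
  subst h; simp [planeDot]; ring

theorem planeDot_smul_right (a x : ℝ × ℝ) (t : ℝ) : planeDot a (t • x) = t * planeDot a x := by
  simp [planeDot]; ring

theorem planeDot_add_right (a x y : ℝ × ℝ) :
    planeDot a (x + y) = planeDot a x + planeDot a y := by
  simp [planeDot]; ring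

theorem planeDot_sub_right (a x y : ℝ × ℝ) :
    planeDot a (x - y) = planeDot a x - planeDot a y := by
  simp [planeDot]; ring

/-- Cramer's rule in the plane. -/
theorem eq_comb_of_planeCross_ne_zero {a b : ℝ × ℝ} (h : planeCross a b ≠ 0) (c : ℝ × ℝ) :
    c = (planeCross c b / planeCross a b) • a + (planeCross a c / planeCross a b) • b := by
  ext <;> simp <;> field_simp <;> simp [planeCross] <;> ring

theorem eq_smul_of_planeCross_eq_zero {a b : ℝ × ℝ} (ha : a ≠ 0) (h : planeCross a b = 0) :
    ∃ t : ℝ, b = t • a := by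
  have hpos : a.1 ^ 2 + a.2 ^ 2 ≠ 0 := by
    intro h0
    apply ha
    ext <;> simp <;> nlinarith [sq_nonneg a.1, sq_nonneg a.2]
  unfold planeCross at h
  refine ⟨planeDot a b / (a.1 ^ 2 + a.2 ^ 2), ?_⟩
  ext <;> simp <;> field_simp <;> simp [planeDot]
  · linear_combination (-a.2) * h
  · linear_combination a.1 * h

/-- Among three vectors in an open half-plane, one lies in the cone spanned by the others. -/
theorem exists_mem_cone {ι : Type*} {d : ι → ℝ × ℝ} {p : ℝ × ℝ} {i j k : ι}
    (hij : i ≠ j) (hik : i ≠ k) (hjk : j ≠ k)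
    (hi : 0 < planeDot (d i) p) (hj : 0 < planeDot (d j) p) (hk : 0 < planeDot (d k) p) :
    ∃ a b c : ι, a ∈ ({i, j, k} : Set ι) ∧ b ∈ ({i, j, k} : Set ι) ∧ c ∈ ({i, j, k} : Set ι) ∧
      a ≠ b ∧ c ≠ b ∧ ∃ s t : ℝ, 0 ≤ s ∧ 0 ≤ t ∧ d b = s • d a + t • d c := by
  have key : planeCross (d j) (d k) * planeDot (d i) p + planeCross (d k) (d i) * planeDot (d j) p
      + planeCross (d i) (d j) * planeDot (d k) p = 0 := by
    simp only [planeCross, planeDot]; ring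
  have anti : ∀ a b : ℝ × ℝ, planeCross a b = - planeCross b a := by
    intro a b; simp only [planeCross]; ring
  -- the vector opposite in sign to the two others in the linear dependence
  have main : ∀ a b c : ι, (planeCross (d a) (d c) ≠ 0) →
      0 ≤ planeCross (d a) (d b) / planeCross (d a) (d c) →
      0 ≤ planeCross (d b) (d c) / planeCross (d a) (d c) →
      ∃ s t : ℝ, 0 ≤ s ∧ 0 ≤ t ∧ d b = s • d a + t • d c := fun a b c h h1 h2 =>
    ⟨_, _, h2, h1, eq_comb_of_planeCross_ne_zero h _⟩
  have hne : ∀ a, 0 < planeDot (d a) p → d a ≠ 0 := by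
    intro a h h0; rw [h0] at h; simp [planeDot] at h
  by_cases z : planeCross (d i) (d j) = 0
  · obtain ⟨t, ht⟩ := eq_smul_of_planeCross_eq_zero (hne i hi) z
    refine ⟨i, j, k, by simp, by simp, by simp, hij, hjk.symm, t, 0, ?_, le_rfl, by simp [ht]⟩
    have : planeDot (d j) p = t * planeDot (d i) p := by rw [ht]; simp [planeDot]; ring
    rw [this] at hj
    exact (pos_of_mul_pos_left hj hi.le).le
  have case : ∀ σ : ℝ, σ * planeCross (d i) (d j) > 0 →
      (σ * planeCross (d j) (d k) ≥ 0 ∧ σ * planeCross (d k) (d i) < 0) ∨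
      (σ * planeCross (d j) (d k) < 0 ∧ σ * planeCross (d k) (d i) ≥ 0) ∨
      (σ * planeCross (d j) (d k) < 0 ∧ σ * planeCross (d k) (d i) < 0) := by
    intro σ h
    by_contra! hcon
    have k1 : σ * planeCross (d j) (d k) * planeDot (d i) p
        + σ * planeCross (d k) (d i) * planeDot (d j) p
        + σ * planeCross (d i) (d j) * planeDot (d k) p = 0 := by linear_combination σ * key
    have := mul_pos h hk
    rcases le_or_gt 0 (σ * planeCross (d j) (d k)) with h1 | h1
    · have := hcon.1 h1
      nlinarith [mul_nonneg h1 hi.le, mul_nonneg this hj.le]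
    · have h2 := hcon.2.1 h1
      have := hcon.2.2 h1
      linarith
  have div_of : ∀ σ x y : ℝ, 0 ≤ σ * x → 0 < σ * y → 0 ≤ x / y := by
    intro σ x y hx hy
    have : σ ≠ 0 := by rintro rfl; simp at hy
    rw [← mul_div_mul_left x y this]
    positivity
  obtain ⟨σ, hσ⟩ : ∃ σ : ℝ, σ * planeCross (d i) (d j) > 0 := ⟨_, mul_self_pos.2 z⟩
  have a1 : σ * planeCross (d i) (d k) = -(σ * planeCross (d k) (d i)) := by rw [anti]; ring
  have a2 : σ * planeCross (d j) (d i) = -(σ * planeCross (d i) (d j)) := by rw [anti]; ring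
  have a3 : σ * planeCross (d k) (d j) = -(σ * planeCross (d j) (d k)) := by rw [anti]; ring
  rcases case σ hσ with ⟨h1, h2⟩ | ⟨h1, h2⟩ | ⟨h1, h2⟩
  · refine ⟨i, j, k, by simp, by simp, by simp, hij, hjk.symm, main i j k ?_ ?_ ?_⟩
    · intro h; rw [h] at a1; linarith
    · apply div_of σ <;> linarith
    · apply div_of σ <;> linarith
  · refine ⟨j, i, k, by simp, by simp, by simp, hij.symm, hik.symm, main j i k ?_ ?_ ?_⟩
    · intro h; rw [h] at h1; simp at h1
    · apply div_of (-σ) <;> linarith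
    · apply div_of (-σ) <;> linarith
  · refine ⟨i, k, j, by simp, by simp, by simp, hik, hjk, main i k j z ?_ ?_⟩
    · apply div_of σ <;> linarith
    · apply div_of σ <;> linarith

/-- Let `b` lie in the cone spanned by `a` and `c`, and let `e` lie on the same side of `b` as `a`.
If `e` misses a point common to the half-planes of `a` and `c`, and reaches a point of the
half-plane of `b` outside those of `a` and `c`, then `e` reaches further than `a` at every point
of the half-plane of `a` outside that of `b`. -/
theorem one_le_planeDot_and_lt_of_cone {a b c e p y x : ℝ × ℝ} {s t β δ : ℝ}
    (hs : 0 ≤ s) (ht : 0 ≤ t) (hb : b = s • a + t • c) (hβ : 0 < β) (ha : a = β • e + δ • b)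
    (pa : 1 ≤ planeDot a p) (pc : 1 ≤ planeDot c p)
    (pe : planeDot e p < 1) (yb : 1 ≤ planeDot b y) (ye : 1 ≤ planeDot e y)
    (ya : planeDot a y < 1) (yc : planeDot c y < 1)
    (xa : 1 ≤ planeDot a x) (xb : planeDot b x < 1) :
    1 ≤ planeDot e x ∧ planeDot a x < planeDot e x := by
  have b1 := planeDot_comb hb
  have a1 := planeDot_comb ha
  have hδ : 0 ≤ δ := by
    by_contra! h
    have e1 : β * planeDot e y = planeDot a y + (-δ) * planeDot b y := by rw [a1 y]; ring
    have e2 : β * planeDot e p = planeDot a p + (-δ) * planeDot b p := by rw [a1 p]; ring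
    have f1 : planeDot b y ≤ s + t := by rw [b1 y]; nlinarith
    have f2 : s + t ≤ planeDot b p := by rw [b1 p]; nlinarith
    nlinarith
  have hlt : β + δ < 1 := by have := a1 y; nlinarith
  have h1 : 1 ≤ planeDot e x := by
    have := a1 x
    by_contra! h
    nlinarith
  refine ⟨h1, ?_⟩
  have := a1 x
  nlinarith

/-- A family of half-planes missing a common point has a subfamily meeting every point covered
at least twice and containing no three half-planes that are all those covering some point. -/
theorem exists_hitting_subset {ι : Type*} [DecidableEq ι] (s : Finset ι) (d : ι → ℝ × ℝ) :
    ∃ N ⊆ s,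
      (∀ p : ℝ × ℝ, ∀ i ∈ s, ∀ j ∈ s, i ≠ j → 1 ≤ planeDot (d i) p → 1 ≤ planeDot (d j) p →
        ∃ n ∈ N, 1 ≤ planeDot (d n) p) ∧
      (∀ p : ℝ × ℝ, ∀ i ∈ s, ∀ j ∈ s, ∀ k ∈ s, i ≠ j → i ≠ k → j ≠ k →
        1 ≤ planeDot (d i) p → 1 ≤ planeDot (d j) p → 1 ≤ planeDot (d k) p →
        ∃ n ∈ s, n ∉ N ∧ 1 ≤ planeDot (d n) p) := by
  obtain ⟨W, hWs, hW⟩ := exists_minimal_le_of_wellFoundedLT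
    (fun W : Finset ι => ∀ p : ℝ × ℝ, ∀ i ∈ s, 1 ≤ planeDot (d i) p →
      ∃ w ∈ W, 1 ≤ planeDot (d w) p) s (fun p i hi h => ⟨i, hi, h⟩)
  obtain ⟨N, hNW, hN⟩ := exists_minimal_le_of_wellFoundedLT
    (fun N : Finset ι => ∀ p : ℝ × ℝ, ∀ i ∈ s, ∀ j ∈ s, i ≠ j → 1 ≤ planeDot (d i) p →
      1 ≤ planeDot (d j) p → ∃ n ∈ N, 1 ≤ planeDot (d n) p) W
    (fun p i hi j hj _ h _ => hW.prop p i hi h)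
  have hWpriv : ∀ w ∈ W, ∃ x, 1 ≤ planeDot (d w) x ∧
      ∀ v ∈ W, v ≠ w → planeDot (d v) x < 1 := by
    intro w hw
    have := hW.not_prop_of_lt (Finset.erase_ssubset hw)
    push Not at this
    obtain ⟨x, i, hi, hix, h⟩ := this
    obtain ⟨v, hv, hvx⟩ := hW.prop x i hi hix
    have hvw : v = w := by
      by_contra hne
      exact absurd hvx (not_le.2 (h v (Finset.mem_erase.2 ⟨hne, hv⟩)))
    exact ⟨x, hvw ▸ hvx, fun v hv hne => h v (Finset.mem_erase.2 ⟨hne, hv⟩)⟩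
  have hNpriv : ∀ n ∈ N, ∃ y, 1 ≤ planeDot (d n) y ∧
      (∀ v ∈ N, v ≠ n → planeDot (d v) y < 1) ∧ ∃ e ∈ s, e ≠ n ∧ 1 ≤ planeDot (d e) y := by
    intro n hn
    have := hN.not_prop_of_lt (Finset.erase_ssubset hn)
    push Not at this
    obtain ⟨y, i, hi, j, hj, hij, hiy, hjy, h⟩ := this
    have h' : ∀ v ∈ N, v ≠ n → planeDot (d v) y < 1 :=
      fun v hv hne => h v (Finset.mem_erase.2 ⟨hne, hv⟩)
    obtain ⟨v, hv, hvy⟩ := hN.prop y i hi j hj hij hiy hjy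
    have hvn : v = n := by
      by_contra hne
      exact absurd hvy (not_le.2 (h' v hv hne))
    refine ⟨y, hvn ▸ hvy, h', ?_⟩
    by_cases hin : i = n
    · exact ⟨j, hj, fun hjn => hij (hin.trans hjn.symm), hjy⟩
    · exact ⟨i, hi, hin, hiy⟩
  refine ⟨N, hNW.trans hWs, hN.prop, ?_⟩
  intro p i hi j hj k hk hij hik hjk hip hjp hkp
  by_contra! hcon
  have hpN : ∀ n ∈ s, 1 ≤ planeDot (d n) p → n ∈ N := by
    intro n hn hnp
    by_contra hnN
    exact absurd hnp (not_le.2 (hcon n hn hnN))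
  have hmem : ∀ a ∈ ({i, j, k} : Set ι), a ∈ N ∧ 1 ≤ planeDot (d a) p := by
    rintro a (rfl | rfl | rfl)
    · exact ⟨hpN _ hi hip, hip⟩
    · exact ⟨hpN _ hj hjp, hjp⟩
    · exact ⟨hpN _ hk hkp, hkp⟩
  obtain ⟨a, b, c, ha, hb, hc, hab, hcb, σ, τ, hσ, hτ, hcone⟩ :=
    exists_mem_cone hij hik hjk (by linarith) (by linarith : 0 < planeDot (d j) p)
      (by linarith : 0 < planeDot (d k) p)
  obtain ⟨haN, hap⟩ := hmem a ha
  obtain ⟨hbN, hbp⟩ := hmem b hb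
  obtain ⟨hcN, hcp⟩ := hmem c hc
  obtain ⟨y, hby, hyN, e, hes, heb, hey⟩ := hNpriv b hbN
  have hay := hyN a haN hab
  have hcy := hyN c hcN hcb
  have hep : planeDot (d e) p < 1 := by
    by_contra! h
    exact absurd hey (not_le.2 (hyN e (hpN e hes h) heb))
  have hb0 : d b ≠ 0 := by intro h0; rw [h0] at hbp; simp [planeDot] at hbp; linarith
  -- no vector of `W` in the family through `p` is parallel to `d b`
  have hpar : ∀ v ∈ N, v ≠ b → 1 ≤ planeDot (d v) p → planeCross (d b) (d v) ≠ 0 := by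
    intro v hv hvb hvp hz
    obtain ⟨r, hr⟩ := eq_smul_of_planeCross_eq_zero hb0 hz
    have hdot : ∀ x, planeDot (d v) x = r * planeDot (d b) x := by
      intro x; rw [hr]; simp [planeDot]; ring
    obtain ⟨x, hx, hx'⟩ := hWpriv v (hNW hv)
    obtain ⟨z, hz, hz'⟩ := hWpriv b (hNW hbN)
    have h1 := hx' b (hNW hbN) hvb.symm
    have h2 := hz' v (hNW hv) hvb
    have h3 := hdot x
    have h4 := hdot z
    have h5 := hdot p
    have hr0 : 0 < r := by by_contra! h; nlinarith
    nlinarith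
  have hside : ∀ a ∈ N, a ≠ b → ∀ (c : ι) (σ τ : ℝ), 0 ≤ σ → 0 ≤ τ → d b = σ • d a + τ • d c →
      1 ≤ planeDot (d a) p → 1 ≤ planeDot (d c) p → planeDot (d a) y < 1 →
      planeDot (d c) y < 1 → 0 < planeCross (d b) (d a) / planeCross (d b) (d e) → False := by
    intro a haN hab c σ τ hσ hτ hcone hap hcp hay hcy hpos
    obtain ⟨x, hx, hx'⟩ := hWpriv a (hNW haN)
    have hne : planeCross (d b) (d e) ≠ 0 := by intro h; simp [h] at hpos
    have hcr := eq_comb_of_planeCross_ne_zero hne (d a)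
    rw [add_comm] at hcr
    obtain ⟨h1, h2⟩ := one_le_planeDot_and_lt_of_cone hσ hτ hcone hpos hcr hap hcp hep hby hey
      hay hcy hx (hx' b (hNW hbN) hab.symm)
    have hE : 0 < planeDot (d e) x := by linarith
    obtain ⟨w, hw, hwx⟩ := hW.prop ((planeDot (d e) x)⁻¹ • x) e hes
      (by rw [planeDot_smul_right, inv_mul_cancel₀ hE.ne'])
    rw [planeDot_smul_right, inv_mul_eq_div, le_div_iff₀ hE, one_mul] at hwx
    by_cases hwa : w = a
    · subst hwa; linarith
    · linarith [hx' w hw hwa]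
  have hma := hpar a haN hab hap
  have hmc := hpar c hcN hcb hcp
  have hrel : σ * planeCross (d b) (d a) + τ * planeCross (d b) (d c) = 0 := by
    have : planeCross (d b) (σ • d a + τ • d c) = 0 := by
      rw [← hcone]; simp [planeCross]; ring
    rw [← this]; simp [planeCross]; ring
  by_cases hk0 : planeCross (d b) (d e) = 0
  · obtain ⟨r, hr⟩ := eq_smul_of_planeCross_eq_zero hb0 hk0
    have hdot : ∀ x, planeDot (d e) x = r * planeDot (d b) x := by
      intro x; rw [hr]; simp [planeDot]; ring
    have f1 : planeDot (d b) y ≤ σ + τ := by rw [planeDot_comb hcone]; nlinarith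
    have f2 : σ + τ ≤ planeDot (d b) p := by rw [planeDot_comb hcone]; nlinarith
    rw [hdot] at hey hep
    have hr0 : 0 < r := by by_contra! h; nlinarith
    nlinarith
  · have hστ : 0 < σ ∨ 0 < τ := by
      by_contra! h
      apply hb0
      rw [hcone, le_antisymm h.1 hσ, le_antisymm h.2 hτ]; simp
    rcases lt_trichotomy (planeCross (d b) (d a) / planeCross (d b) (d e)) 0 with h | h | h
    · apply hside c hcN hcb a τ σ hτ hσ (by rw [hcone, add_comm]) hcp hap hcy hay
      by_contra! h'
      have h'' : planeCross (d b) (d c) / planeCross (d b) (d e) < 0 :=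
        lt_of_le_of_ne h' (div_ne_zero hmc hk0)
      have hrel' : σ * (planeCross (d b) (d a) / planeCross (d b) (d e)) +
          τ * (planeCross (d b) (d c) / planeCross (d b) (d e)) = 0 := by
        rw [mul_div_assoc', mul_div_assoc', ← add_div, hrel, zero_div]
      rcases hστ with h1 | h1
      · nlinarith [mul_pos h1 (neg_pos.2 h), mul_nonneg hτ (neg_pos.2 h'').le]
      · nlinarith [mul_pos h1 (neg_pos.2 h''), mul_nonneg hσ (neg_pos.2 h).le]
    · exact absurd h (div_ne_zero hma hk0)
    · exact hside a haN hab c σ τ hσ hτ hcone hap hcp hay hcy h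

/-- Three half-planes covering the plane, of which `A` and `B` do not cover it, have no common
weak recession direction that leaves `C`. -/
theorem false_of_escape {A B C : Set (ℝ × ℝ)} {a b c : ℝ × ℝ} {α β γ : ℝ} {u x : ℝ × ℝ}
    (hA : ∀ p, p ∈ A ↔ planeDot a p ≤ α) (hB : ∀ p, p ∈ B ↔ planeDot b p ≤ β)
    (hC : ∀ p, p ∈ C ↔ planeDot c p ≤ γ) (hcov : ∀ p, p ∈ A ∨ p ∈ B ∨ p ∈ C)
    (hxA : x ∉ A) (hxB : x ∉ B)
    (ha : 0 ≤ planeDot a u) (hb : 0 ≤ planeDot b u) (hc : 0 < planeDot c u) : False := by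
  rw [hA] at hxA
  rw [hB] at hxB
  obtain ⟨n, hn⟩ := exists_nat_gt ((γ - planeDot c x) / planeDot c u)
  rw [div_lt_iff₀ hc] at hn
  have hn0 : (0 : ℝ) ≤ n := n.cast_nonneg
  have := hcov (x + (n : ℝ) • u)
  simp only [hA, hB, hC, planeDot_add_right, planeDot_smul_right] at this
  rcases this with h | h | h
  · nlinarith [mul_nonneg hn0 ha]
  · nlinarith [mul_nonneg hn0 hb]
  · linarith

/-- If `A` and `B` have normals in the same direction, one of them is redundant in a cover. -/
theorem false_of_normals_codirectional {A B C : Set (ℝ × ℝ)} {a b : ℝ × ℝ} {α β κ : ℝ}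
    {x y : ℝ × ℝ} (hA : ∀ p, p ∈ A ↔ planeDot a p ≤ α) (hB : ∀ p, p ∈ B ↔ planeDot b p ≤ β)
    (hcov : ∀ p, p ∈ A ∨ p ∈ B ∨ p ∈ C) (hκ : 0 < κ) (hab : a = κ • b)
    (hxA : x ∉ A) (hxC : x ∉ C) (hyB : y ∉ B) (hyC : y ∉ C) : False := by
  have hdot : ∀ p, planeDot a p = κ * planeDot b p := by
    intro p; rw [hab]; simp [planeDot]; ring
  have hxB := ((hcov x).resolve_left hxA).resolve_right hxC
  have hyA := (hcov y).resolve_right (by tauto)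
  rw [hA, hdot] at hxA hyA
  rw [hB] at hxB hyB
  nlinarith

/-- The normals of three half-planes covering the plane, no two of which cover it, are not
all parallel. -/
theorem false_of_normals_parallel {A B C : Set (ℝ × ℝ)} {a b c : ℝ × ℝ} {α β γ : ℝ}
    (hA : ∀ p, p ∈ A ↔ planeDot a p ≤ α) (hB : ∀ p, p ∈ B ↔ planeDot b p ≤ β)
    (hC : ∀ p, p ∈ C ↔ planeDot c p ≤ γ) (hcov : ∀ p, p ∈ A ∨ p ∈ B ∨ p ∈ C)
    (hAB : ∃ x, x ∉ A ∧ x ∉ B) (hAC : ∃ x, x ∉ A ∧ x ∉ C) (hBC : ∃ x, x ∉ B ∧ x ∉ C)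
    (ha : a ≠ 0) (hb : b ≠ 0) (hc : c ≠ 0)
    (hba : planeCross b a = 0) (hbc : planeCross b c = 0) : False := by
  obtain ⟨s, rfl⟩ := eq_smul_of_planeCross_eq_zero hb hba
  obtain ⟨t, rfl⟩ := eq_smul_of_planeCross_eq_zero hb hbc
  have hs : s ≠ 0 := by rintro rfl; simp at ha
  have ht : t ≠ 0 := by rintro rfl; simp at hc
  obtain ⟨x, hxA, hxB⟩ := hAB
  obtain ⟨y, hyA, hyC⟩ := hAC
  obtain ⟨z, hzB, hzC⟩ := hBC
  rcases hs.lt_or_gt with hs | hs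
  · rcases ht.lt_or_gt with ht | ht
    · refine false_of_normals_codirectional hA hC (C := B) (fun p => ?_) (div_pos_of_neg_of_neg hs ht)
        ?_ hxA hxB hzC hzB
      · have := hcov p; tauto
      · rw [smul_smul, div_mul_cancel₀ _ ht.ne]
    · refine false_of_normals_codirectional hC hB (C := A) (fun p => ?_) ht rfl hyC hyA hxB hxA
      have := hcov p; tauto
  · exact false_of_normals_codirectional hA hB hcov hs rfl hyA hyC hzB hzC

/-- Three of the four triples of half-planes in a quadruple cannot cover the plane unless two
of the half-planes do. -/
theorem false_of_three_covering_triples {A B C D : Set (ℝ × ℝ)} {a b c d : ℝ × ℝ} {α β γ δ : ℝ}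
    (hA : ∀ p, p ∈ A ↔ planeDot a p ≤ α) (hB : ∀ p, p ∈ B ↔ planeDot b p ≤ β)
    (hC : ∀ p, p ∈ C ↔ planeDot c p ≤ γ) (hD : ∀ p, p ∈ D ↔ planeDot d p ≤ δ)
    (hABC : ∀ p, p ∈ A ∨ p ∈ B ∨ p ∈ C) (hABD : ∀ p, p ∈ A ∨ p ∈ B ∨ p ∈ D)
    (hBCD : ∀ p, p ∈ B ∨ p ∈ C ∨ p ∈ D)
    (hAB : ∃ x, x ∉ A ∧ x ∉ B) (hAC : ∃ x, x ∉ A ∧ x ∉ C) (hBC : ∃ x, x ∉ B ∧ x ∉ C)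
    (hBD : ∃ x, x ∉ B ∧ x ∉ D)
    (ha : a ≠ 0) (hb : b ≠ 0) (hc : c ≠ 0) : False := by
  have key : ∀ u, planeDot b u = 0 →
      ¬ (0 ≤ planeDot a u ∧ 0 < planeDot c u) ∧ ¬ (0 < planeDot a u ∧ 0 ≤ planeDot c u) ∧
      ¬ (0 ≤ planeDot a u ∧ 0 < planeDot d u) ∧ ¬ (0 < planeDot a u ∧ 0 ≤ planeDot d u) ∧
      ¬ (0 ≤ planeDot c u ∧ 0 < planeDot d u) ∧ ¬ (0 < planeDot c u ∧ 0 ≤ planeDot d u) := by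
    obtain ⟨x, hxA, hxB⟩ := hAB
    obtain ⟨z, hzB, hzC⟩ := hBC
    obtain ⟨w, hwB, hwD⟩ := hBD
    intro u hu
    refine ⟨?_, ?_, ?_, ?_, ?_, ?_⟩ <;> rintro ⟨h1, h2⟩
    · exact false_of_escape hA hB hC hABC hxA hxB h1 hu.ge h2
    · exact false_of_escape hB hC hA (fun p => by have := hABC p; tauto) hzB hzC hu.ge h2 h1
    · exact false_of_escape hA hB hD hABD hxA hxB h1 hu.ge h2
    · exact false_of_escape hB hD hA (fun p => by have := hABD p; tauto) hwB hwD hu.ge h2 h1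
    · exact false_of_escape hB hC hD hBCD hzB hzC hu.ge h1 h2
    · exact false_of_escape hB hD hC (fun p => by have := hBCD p; tauto) hwB hwD hu.ge h2 h1
  have hdot : ∀ v : ℝ × ℝ, planeDot v (-b.2, b.1) = planeCross b v ∧
      planeDot v (b.2, -b.1) = - planeCross b v := by
    intro v; simp only [planeDot, planeCross]; constructor <;> ring
  have k1 := key (-b.2, b.1) (by simp only [planeDot]; ring)
  have k2 := key (b.2, -b.1) (by simp only [planeDot]; ring)
  simp only [hdot] at k1 k2
  refine false_of_normals_parallel hA hB hC hABC hAB hAC hBC ha hb hc ?_ ?_ <;>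
  · generalize planeCross b a = X at *
    generalize planeCross b c = Y at *
    generalize planeCross b d = Z at *
    clear * - k1 k2
    grind

/-- Coloring a family of half-planes whose members other than `C` do not cover the plane. -/
theorem exists_coloring_of_erase_not_cover (F : Finset (Set (ℝ × ℝ)))
    (n : Set (ℝ × ℝ) → ℝ × ℝ) (c : Set (ℝ × ℝ) → ℝ)
    (hn : ∀ h ∈ F, ∀ p, p ∈ h ↔ planeDot (n h) p ≤ c h) (C : Set (ℝ × ℝ)) (o : ℝ × ℝ)
    (ho : ∀ h ∈ F, h ≠ C → o ∉ h) :
    ∃ N : Set (Set (ℝ × ℝ)), ∀ p : ℝ × ℝ, ∀ i ∈ F, ∀ j ∈ F, ∀ k ∈ F, i ≠ j → i ≠ k → j ≠ k →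
      p ∈ i → p ∈ j → p ∈ k → (∃ h ∈ F, p ∈ h ∧ h ∈ N) ∧ (∃ h ∈ F, p ∈ h ∧ h ∉ N) := by
  classical
  obtain ⟨N, hNF, h2, h3⟩ := exists_hitting_subset (F.erase C)
    (fun h => (c h - planeDot (n h) o)⁻¹ • n h)
  have hmem : ∀ h ∈ F.erase C, ∀ p,
      1 ≤ planeDot ((c h - planeDot (n h) o)⁻¹ • n h) (p - o) ↔ p ∈ h := by
    intro h hh p
    obtain ⟨hC, hF⟩ := Finset.mem_erase.1 hh
    have h0 := ho h hF hC
    rw [hn h hF] at h0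
    have hs : planeDot ((c h - planeDot (n h) o)⁻¹ • n h) (p - o) =
        (planeDot (n h) o - planeDot (n h) p) / (planeDot (n h) o - c h) := by
      rw [← neg_div_neg_eq, div_eq_inv_mul, neg_sub, neg_sub]
      simp [planeDot]; ring
    rw [hn h hF, hs, one_le_div (by linarith)]
    constructor <;> intro <;> linarith
  have two : ∀ p, ∀ i ∈ F.erase C, ∀ j ∈ F.erase C, i ≠ j → p ∈ i → p ∈ j →
      ∃ h ∈ F, p ∈ h ∧ h ∈ N := by
    intro p i hi j hj hij hpi hpj
    obtain ⟨m, hm, hpm⟩ := h2 (p - o) i hi j hj hij ((hmem i hi p).2 hpi) ((hmem j hj p).2 hpj)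
    exact ⟨m, Finset.mem_of_mem_erase (hNF hm), (hmem m (hNF hm) p).1 hpm, hm⟩
  have hCN : C ∉ N := fun h => Finset.notMem_erase C F (hNF h)
  refine ⟨N, ?_⟩
  intro p i hi j hj k hk hij hik hjk hpi hpj hpk
  by_cases hiC : i = C
  · subst hiC
    exact ⟨two p j (Finset.mem_erase.2 ⟨hij.symm, hj⟩) k (Finset.mem_erase.2 ⟨hik.symm, hk⟩) hjk
      hpj hpk, i, hi, hpi, hCN⟩
  by_cases hjC : j = C
  · subst hjC
    exact ⟨two p i (Finset.mem_erase.2 ⟨hij, hi⟩) k (Finset.mem_erase.2 ⟨hjk.symm, hk⟩) hik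
      hpi hpk, j, hj, hpj, hCN⟩
  have hi' := Finset.mem_erase.2 ⟨hiC, hi⟩
  have hj' := Finset.mem_erase.2 ⟨hjC, hj⟩
  refine ⟨two p i hi' j hj' hij hpi hpj, ?_⟩
  by_cases hkC : k = C
  · subst hkC
    exact ⟨k, hk, hpk, hCN⟩
  have hk' := Finset.mem_erase.2 ⟨hkC, hk⟩
  obtain ⟨m, hm, hmN, hpm⟩ := h3 (p - o) i hi' j hj' k hk' hij hik hjk
    ((hmem i hi' p).2 hpi) ((hmem j hj' p).2 hpj) ((hmem k hk' p).2 hpk)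
  exact ⟨m, Finset.mem_of_mem_erase hm, (hmem m hm p).1 hpm, hmN⟩

/-- Helly's theorem for covers by half-planes. -/
theorem exists_cover_card_le_three (F : Finset (Set (ℝ × ℝ)))
    (n : Set (ℝ × ℝ) → ℝ × ℝ) (c : Set (ℝ × ℝ) → ℝ)
    (hn : ∀ h ∈ F, ∀ p, p ∈ h ↔ planeDot (n h) p ≤ c h) (hcov : ∀ p, ∃ h ∈ F, p ∈ h) :
    ∃ T ⊆ F, T.card ≤ 3 ∧ ∀ p, ∃ h ∈ T, p ∈ h := by
  by_contra! hcon
  have hconv : ∀ h ∈ F, Convex ℝ (hᶜ : Set (ℝ × ℝ)) := by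
    intro h hh x hx y hy s t hs ht hst
    rw [Set.mem_compl_iff, hn h hh] at *
    rw [planeDot_add_right, planeDot_smul_right, planeDot_smul_right]
    push Not at *
    rcases hs.eq_or_lt with rfl | hs
    · rw [zero_add] at hst; subst hst; linarith
    · have hc : s * c h + t * c h = c h := by rw [← add_mul, hst, one_mul]
      linarith [mul_lt_mul_of_pos_left hx hs, mul_le_mul_of_nonneg_left hy.le ht]
  obtain ⟨p, hp⟩ := Convex.helly_theorem' (𝕜 := ℝ) (F := fun h : Set (ℝ × ℝ) => hᶜ) (s := F)
    hconv (by
    intro I hI hcard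
    obtain ⟨p, hp⟩ := hcon I hI (by simpa using hcard)
    exact ⟨p, by simpa using hp⟩)
  obtain ⟨h, hh, hph⟩ := hcov p
  simp only [Set.mem_iInter, Set.mem_compl_iff] at hp
  exact hp h hh hph

/-- If removing any half-plane from a family leaves a cover of the plane, there is a covering
subfamily of at most three half-planes such that no point lies in these three only. -/
theorem exists_cover_not_exact (F : Finset (Set (ℝ × ℝ)))
    (n : Set (ℝ × ℝ) → ℝ × ℝ) (c : Set (ℝ × ℝ) → ℝ) (hn0 : ∀ h ∈ F, n h ≠ 0)
    (hn : ∀ h ∈ F, ∀ p, p ∈ h ↔ planeDot (n h) p ≤ c h)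
    (hcov : ∀ C, ∀ p, ∃ h ∈ F, h ≠ C ∧ p ∈ h) :
    ∃ T ⊆ F, (∀ p, ∃ h ∈ T, p ∈ h) ∧
      (T.card = 3 → ∀ p, ¬ ∀ h ∈ F, p ∈ h ↔ h ∈ T) ∧ T.card ≤ 3 := by
  classical
  by_contra hcon
  have hex : ∀ T ⊆ F, (∀ p, ∃ h ∈ T, p ∈ h) → T.card ≤ 3 →
      T.card = 3 ∧ ∃ p, ∀ h ∈ F, p ∈ h ↔ h ∈ T := by
    intro T hT hT' hc
    by_contra hno
    exact hcon ⟨T, hT, hT', fun h3 p hp => hno ⟨h3, p, hp⟩, hc⟩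
  have hpair : ∀ A ∈ F, ∀ B ∈ F, ∃ x, x ∉ A ∧ x ∉ B := by
    intro A hA B hB
    by_contra! h
    have := (hex {A, B} (by intro x; simp; rintro (rfl | rfl) <;> assumption)
      (fun p => by have := h p; simp; tauto) (Finset.card_le_two.trans (by norm_num))).1
    have := Finset.card_le_two (a := A) (b := B)
    omega
  have havoid : ∀ C, ∃ T ⊆ F, C ∉ T ∧ T.card = 3 ∧ (∀ p, ∃ h ∈ T, p ∈ h) := by
    intro C
    obtain ⟨T, hT, hc, hT'⟩ := exists_cover_card_le_three (F.erase C) n c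
      (fun h hh => hn h (Finset.mem_of_mem_erase hh))
      (fun p => by obtain ⟨h, h1, h2, h3⟩ := hcov C p; exact ⟨h, Finset.mem_erase.2 ⟨h2, h1⟩, h3⟩)
    have hTF := hT.trans (Finset.erase_subset _ _)
    exact ⟨T, hTF, fun h => Finset.notMem_erase C F (hT h), (hex T hTF hT' hc).1, hT'⟩
  have hstep : ∀ T ⊆ F, T.card = 3 → (∀ p, ∃ h ∈ T, p ∈ h) → ∀ A ∈ T, ∀ u,
      (∀ h ∈ T, h ≠ A → 0 < planeDot (n h) u) → planeDot (n A) u < 0 := by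
    intro T hT hc hT' A hA u hu
    by_contra! hAu
    have h2 : (T.erase A).card = 2 := by rw [Finset.card_erase_of_mem hA, hc]
    obtain ⟨B, C, hBC, hE⟩ := Finset.card_eq_two.1 h2
    have hB : B ∈ T.erase A := by simp [hE]
    have hC : C ∈ T.erase A := by simp [hE]
    rw [Finset.mem_erase] at hB hC
    obtain ⟨x, hxA, hxB⟩ := hpair A (hT hA) B (hT hB.2)
    refine false_of_escape (hn A (hT hA)) (hn B (hT hB.2)) (hn C (hT hC.2)) (fun p => ?_) hxA hxB
      hAu (hu B hB.2 hB.1).le (hu C hC.2 hC.1)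
    obtain ⟨h, hh, hp⟩ := hT' p
    rw [← Finset.insert_erase hA, hE] at hh
    simp at hh
    rcases hh with rfl | rfl | rfl <;> tauto
  have hinter : ∀ T ⊆ F, ∀ T' ⊆ F, T.card = 3 → T'.card = 3 → (∀ p, ∃ h ∈ T, p ∈ h) →
      (∀ p, ∃ h ∈ T', p ∈ h) → 2 ≤ (T ∩ T').card := by
    intro T hT T' hT' hc hc' hcT hcT'
    obtain ⟨q, hq⟩ := (hex T hT hcT hc.le).2
    obtain ⟨q', hq'⟩ := (hex T' hT' hcT' hc'.le).2
    by_contra! hlt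
    obtain ⟨A, hA', hqA⟩ := hcT' q
    have hA := (hq A (hT' hA')).1 hqA
    have huniq : ∀ h, h ∈ T → h ∈ T' → h = A := fun h h1 h2 =>
      Finset.card_le_one.1 (Nat.lt_succ_iff.1 hlt) h (Finset.mem_inter.2 ⟨h1, h2⟩) A
        (Finset.mem_inter.2 ⟨hA, hA'⟩)
    have h1 := hstep T hT hc hcT A hA (q' - q) (by
      intro h hh hne
      have i1 := (hq h (hT hh)).2 hh
      have i2 := mt (hq' h (hT hh)).1 (fun hh' => hne (huniq h hh hh'))
      rw [hn h (hT hh)] at i1 i2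
      rw [planeDot_sub_right]; linarith)
    have h2 := hstep T' hT' hc' hcT' A hA' (q - q') (by
      intro h hh hne
      have i1 := (hq' h (hT' hh)).2 hh
      have i2 := mt (hq h (hT' hh)).1 (fun hh' => hne (huniq h hh' hh))
      rw [hn h (hT' hh)] at i1 i2
      rw [planeDot_sub_right]; linarith)
    rw [planeDot_sub_right] at h1 h2
    linarith
  obtain ⟨T, hT, -, hc, hcT⟩ := havoid ∅
  obtain ⟨A, B, C, hAB, hAC, hBC, rfl⟩ := Finset.card_eq_three.1 hc
  -- a covering triple avoiding one element of another contains the two remaining ones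
  have hswap : ∀ A B C : Set (ℝ × ℝ), A ≠ B → A ≠ C → B ≠ C → {A, B, C} ⊆ F →
      (∀ p, ∃ h ∈ ({A, B, C} : Finset (Set (ℝ × ℝ))), p ∈ h) →
      ∃ D ∈ F, D ≠ A ∧ D ≠ B ∧ D ≠ C ∧
        ∀ p, ∃ h ∈ ({A, B, D} : Finset (Set (ℝ × ℝ))), p ∈ h := by
    intro A B C hAB hAC hBC hT hcT
    obtain ⟨T', hT', hCT', hc', hcT'⟩ := havoid C
    have h2 := hinter _ hT T' hT' (Finset.card_eq_three.2 ⟨A, B, C, hAB, hAC, hBC, rfl⟩) hc' hcT hcT'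
    have hsub : ({A, B, C} : Finset (Set (ℝ × ℝ))) ∩ T' ⊆ {A, B} := by
      intro x hx
      simp only [Finset.mem_inter, Finset.mem_insert, Finset.mem_singleton] at hx ⊢
      rcases hx with ⟨rfl | rfl | rfl, hx⟩ <;> tauto
    have heq := Finset.eq_of_subset_of_card_le hsub (Finset.card_le_two.trans h2)
    have hsub' : {A, B} ⊆ T' := heq ▸ Finset.inter_subset_right
    have hd : (T' \ {A, B}).card = 1 := by
      rw [Finset.card_sdiff_of_subset hsub', hc', Finset.card_pair hAB]
    obtain ⟨D, hD⟩ := Finset.card_eq_one.1 hd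
    have hDT : D ∈ T' \ {A, B} := by simp [hD]
    simp only [Finset.mem_sdiff, Finset.mem_insert, Finset.mem_singleton, not_or] at hDT
    refine ⟨D, hT' hDT.1, hDT.2.1, hDT.2.2, fun h => hCT' (h ▸ hDT.1), fun p => ?_⟩
    obtain ⟨h, hh, hp⟩ := hcT' p
    refine ⟨h, ?_, hp⟩
    rw [← Finset.sdiff_union_of_subset hsub', hD] at hh
    simp at hh ⊢; tauto
  obtain ⟨D, hDF, hDA, hDB, hDC, hABD⟩ := hswap A B C hAB hAC hBC hT hcT
  have hperm : ({B, C, A} : Finset (Set (ℝ × ℝ))) = {A, B, C} := by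
    ext x; simp; tauto
  obtain ⟨E, hEF, hEB, hEC, hEA, hBCE⟩ := hswap B C A hBC hAB.symm hAC.symm (hperm ▸ hT)
    (by rw [hperm]; exact hcT)
  have hAF : A ∈ F := hT (by simp)
  have hBF : B ∈ F := hT (by simp)
  have hCF : C ∈ F := hT (by simp)
  have hDE : D = E := by
    by_contra hne
    have h2 := hinter {A, B, D} (by intro x; simp; rintro (rfl | rfl | rfl) <;> assumption)
      {B, C, E} (by intro x; simp; rintro (rfl | rfl | rfl) <;> assumption)
      (Finset.card_eq_three.2 ⟨A, B, D, hAB, hDA.symm, hDB.symm, rfl⟩)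
      (Finset.card_eq_three.2 ⟨B, C, E, hBC, hEB.symm, hEC.symm, rfl⟩) hABD hBCE
    have hsub : ({A, B, D} : Finset (Set (ℝ × ℝ))) ∩ {B, C, E} ⊆ {B} := by
      intro x hx
      simp only [Finset.mem_inter, Finset.mem_insert, Finset.mem_singleton] at hx ⊢
      rcases hx with ⟨rfl | rfl | rfl, hx⟩ <;> tauto
    have := Finset.card_le_card hsub
    rw [Finset.card_singleton] at this
    omega
  subst hDE
  refine false_of_three_covering_triples (hn A hAF) (hn B hBF) (hn C hCF) (hn D hDF)
    (fun p => ?_) (fun p => ?_) (fun p => ?_) (hpair A hAF B hBF) (hpair A hAF C hCF)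
    (hpair B hBF C hCF) (hpair B hBF D hDF) (hn0 A hAF) (hn0 B hBF) (hn0 C hCF)
  · simpa using hcT p
  · simpa using hABD p
  · simpa using hBCE p

/-- Any finite set of closed half-planes can be 2-colored so that every point
covered by at least three half-planes is covered by half-planes of both colors. -/
theorem halfplane_three_coloring
    (H : Set (Set (ℝ × ℝ))) (hfin : H.Finite) (hH : ∀ h ∈ H, IsHalfPlane h) :
    ∃ χ : Set (ℝ × ℝ) → Bool,
      ∀ p : ℝ × ℝ, 3 ≤ {h ∈ H | p ∈ h}.ncard →
        (∃ h ∈ H, p ∈ h ∧ χ h = true) ∧ (∃ h ∈ H, p ∈ h ∧ χ h = false) := by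
  classical
  obtain ⟨F, rfl⟩ := hfin.exists_finset_coe
  have hrep : ∀ h : Set (ℝ × ℝ), ∃ n : ℝ × ℝ, ∃ c : ℝ, h ∈ F →
      n ≠ 0 ∧ ∀ p, p ∈ h ↔ planeDot n p ≤ c := by
    intro h
    by_cases hh : h ∈ F
    · obtain ⟨a, b, c, h0, rfl⟩ := hH h hh
      exact ⟨(a, b), c, fun _ => ⟨h0, fun p => Iff.rfl⟩⟩
    · exact ⟨0, 0, fun h' => absurd h' hh⟩
  choose n c hnc using hrep
  have hn : ∀ h ∈ F, ∀ p, p ∈ h ↔ planeDot (n h) p ≤ c h := fun h hh => (hnc h hh).2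
  have hcard : ∀ p : ℝ × ℝ, {h ∈ (F : Set (Set (ℝ × ℝ))) | p ∈ h}.ncard =
      (F.filter (fun h => p ∈ h)).card := by
    intro p
    rw [← Set.ncard_coe_finset]
    congr 1
    ext h; simp
  suffices ∃ N : Set (Set (ℝ × ℝ)), ∀ p : ℝ × ℝ, 3 ≤ (F.filter (fun h => p ∈ h)).card →
      (∃ h ∈ F, p ∈ h ∧ h ∈ N) ∧ (∃ h ∈ F, p ∈ h ∧ h ∉ N) by
    obtain ⟨N, hN⟩ := this
    refine ⟨fun h => decide (h ∈ N), fun p hp => ?_⟩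
    rw [hcard] at hp
    simpa using hN p hp
  by_cases hcov : ∀ C, ∀ p, ∃ h ∈ F, h ≠ C ∧ p ∈ h
  · obtain ⟨T, hT, hcT, hex, hc⟩ :=
      exists_cover_not_exact F n c (fun h hh => (hnc h hh).1) hn hcov
    refine ⟨T, fun p hp => ⟨?_, ?_⟩⟩
    · obtain ⟨h, hh, hph⟩ := hcT p
      exact ⟨h, hT hh, hph, hh⟩
    · by_contra! hno
      have hsub : F.filter (fun h => p ∈ h) ⊆ T := by
        intro h hh
        rw [Finset.mem_filter] at hh
        exact hno h hh.1 hh.2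
      have heq := Finset.eq_of_subset_of_card_le hsub (hc.trans hp)
      refine hex (by rw [heq] at hp; omega) p (fun h hh => ?_)
      rw [← heq, Finset.mem_filter]
      simp [hh]
  · push Not at hcov
    obtain ⟨C, o, ho⟩ := hcov
    obtain ⟨N, hN⟩ := exists_coloring_of_erase_not_cover F n c hn C o ho
    refine ⟨N, fun p hp => ?_⟩
    obtain ⟨i, j, k, hi, hj, hk, hij, hik, hjk⟩ := Finset.two_lt_card_iff.1 hp
    rw [Finset.mem_filter] at hi hj hk
    exact hN p i hi.1 j hj.1 k hk.1 hij hik hjk hi.2 hj.2 hk.2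
end

section
/- Any finite set of points in ℝ² in general position (no three collinear, distinct x-coordinates) can be 2-colored so that every closed half-plane containing at least three of the points contains points of both colors. -/
/-- `p` is the unique minimizer on `V` of some linear functional. -/
def IsVertex (V : Set (ℝ × ℝ)) (p : ℝ × ℝ) : Prop :=
  p ∈ V ∧ ∃ E : ℝ × ℝ →ₗ[ℝ] ℝ, ∀ q ∈ V, q ≠ p → E p < E q

/-- `T` is a set of three points of `V` cut off from the rest of `V` by a line. -/
def IsSeparableTriple (V : Set (ℝ × ℝ)) (T : Finset (ℝ × ℝ)) : Prop :=
  (T : Set (ℝ × ℝ)) ⊆ V ∧ T.card = 3 ∧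
    ∃ (F : ℝ × ℝ →ₗ[ℝ] ℝ) (k : ℝ), (∀ p ∈ T, F p ≤ k) ∧ ∀ p ∈ V, p ∉ T → k < F p

/-- The barycentric coordinates of `d` with respect to `x, y, z` are negative at `x` and
nonnegative at `y` and `z`. -/
def IsOpposite (x y z d : ℝ × ℝ) : Prop :=
  ∃ α β γ : ℝ, α + β + γ = 1 ∧ α < 0 ∧ 0 ≤ β ∧ 0 ≤ γ ∧ d = α • x + β • y + γ • z

theorem IsOpposite.swap {x y z d : ℝ × ℝ} (h : IsOpposite x y z d) : IsOpposite x z y d := by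
  obtain ⟨α, β, γ, hs, hα, hβ, hγ, rfl⟩ := h
  exact ⟨α, γ, β, by linarith, hα, hγ, hβ, by abel⟩

theorem IsOpposite.not_separated {x y z d : ℝ × ℝ} (h : IsOpposite x y z d)
    (G : ℝ × ℝ →ₗ[ℝ] ℝ) {l : ℝ} (hx : G x ≤ l) (hd : G d ≤ l) (hy : l < G y) (hz : l < G z) :
    False := by
  obtain ⟨α, β, γ, hs, hα, hβ, hγ, rfl⟩ := h
  simp only [map_add, map_smul, smul_eq_mul] at hd
  have h1 : 0 ≤ β * (G y - l) := mul_nonneg hβ (by linarith)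
  have h2 : 0 ≤ γ * (G z - l) := mul_nonneg hγ (by linarith)
  have h3 : 0 ≤ α * (G x - l) := mul_nonneg_of_nonpos_of_nonpos hα.le (by linarith)
  have h4 : (α + β + γ) * l = l := by rw [hs, one_mul]
  have h5 : β * (G y - l) = 0 := by linarith
  have h6 : γ * (G z - l) = 0 := by linarith
  rcases mul_eq_zero.1 h5 with h5 | h5
  · rcases mul_eq_zero.1 h6 with h6 | h6 <;> linarith
  · linarith

theorem not_isOpposite_of_isOpposite {a b c d d' : ℝ × ℝ} (h : IsOpposite b a c d)
    (h' : IsOpposite c a b d') (F : ℝ × ℝ →ₗ[ℝ] ℝ) {k : ℝ} (ha : F a ≤ k) (hb : F b ≤ k)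
    (hc : F c ≤ k) (hd : k < F d) (hd' : k < F d') (E : ℝ × ℝ →ₗ[ℝ] ℝ) (hEb : E a < E b)
    (hEd : E a < E d) (hEd' : E a < E d') : False := by
  obtain ⟨β, α, γ, hs, hβ, hα, hγ, rfl⟩ := h
  obtain ⟨γ', α', β', hs', hγ', hα', hβ', rfl⟩ := h'
  simp only [map_add, map_smul, smul_eq_mul] at hd hd' hEd hEd'
  obtain rfl : α = 1 - β - γ := by linarith
  obtain rfl : α' = 1 - β' - γ' := by linarith
  have h1 : γ * (k - F c) < -β * (k - F b) := by
    nlinarith [mul_nonneg hα (sub_nonneg.2 ha)]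
  have h2 : β' * (k - F b) < -γ' * (k - F c) := by
    nlinarith [mul_nonneg hα' (sub_nonneg.2 ha)]
  have hB : 0 < k - F b := by
    by_contra! hB
    nlinarith [mul_nonneg hγ (sub_nonneg.2 hc)]
  have hC : 0 < k - F c := by
    by_contra! hC
    nlinarith [mul_nonneg hβ' hB.le]
  have h3 : γ * β' ≤ β * γ' := by
    by_contra! h3
    have h4 := mul_lt_mul'' h1 h2 (by positivity) (by positivity)
    nlinarith [mul_pos hB hC]
  have h5 : 0 < β * (E b - E a) + γ * (E c - E a) := by linarith
  have h6 : 0 < γ' * (E c - E a) + β' * (E b - E a) := by linarith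
  nlinarith [mul_pos (neg_pos.2 hγ') h5, mul_nonneg hγ h6.le,
    mul_nonneg (sub_nonneg.2 h3) (sub_pos.2 hEb).le]

theorem exists_barycentric {a b c : ℝ × ℝ} (hab : a.1 ≠ b.1)
    (h : ¬ Collinear ℝ ({a, b, c} : Set (ℝ × ℝ))) (d : ℝ × ℝ) :
    ∃ α β γ : ℝ, α + β + γ = 1 ∧ d = α • a + β • b + γ • c := by
  have hab' : b.1 - a.1 ≠ 0 := sub_ne_zero.2 hab.symm
  have hD : (b.1 - a.1) * (c.2 - a.2) - (b.2 - a.2) * (c.1 - a.1) ≠ 0 := by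
    intro hD
    apply h
    rw [collinear_iff_of_mem (p₀ := a) (by simp)]
    refine ⟨b - a, ?_⟩
    simp only [Set.mem_insert_iff, Set.mem_singleton_iff, forall_eq_or_imp, forall_eq]
    refine ⟨⟨0, by simp⟩, ⟨1, by simp⟩, (c.1 - a.1) / (b.1 - a.1), ?_⟩
    ext
    · simp; field_simp; ring
    · simp; field_simp; linarith
  set D := (b.1 - a.1) * (c.2 - a.2) - (b.2 - a.2) * (c.1 - a.1) with hDdef
  set β := ((d.1 - a.1) * (c.2 - a.2) - (d.2 - a.2) * (c.1 - a.1)) / D with hβ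
  set γ := ((b.1 - a.1) * (d.2 - a.2) - (b.2 - a.2) * (d.1 - a.1)) / D with hγ
  have hβ' : β * D = (d.1 - a.1) * (c.2 - a.2) - (d.2 - a.2) * (c.1 - a.1) :=
    div_mul_cancel₀ _ hD
  have hγ' : γ * D = (b.1 - a.1) * (d.2 - a.2) - (b.2 - a.2) * (d.1 - a.1) :=
    div_mul_cancel₀ _ hD
  refine ⟨1 - β - γ, β, γ, by ring, ?_⟩
  ext
  · simp only [Prod.fst_add, Prod.smul_fst, smul_eq_mul]
    apply mul_right_cancel₀ hD
    linear_combination (-(b.1 - a.1)) * hβ' - (c.1 - a.1) * hγ' + (d.1 - a.1) * hDdef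
  · simp only [Prod.snd_add, Prod.smul_snd, smul_eq_mul]
    apply mul_right_cancel₀ hD
    linear_combination (-(b.2 - a.2)) * hβ' - (c.2 - a.2) * hγ' + (d.2 - a.2) * hDdef

theorem not_barycentric_of_minimizer {a b c d : ℝ × ℝ} (E : ℝ × ℝ →ₗ[ℝ] ℝ) (hb : E a < E b)
    (hc : E a < E c) (hd : E a < E d) {α β γ : ℝ} (hs : α + β + γ = 1)
    (h : d = α • a + β • b + γ • c) (hβ : β ≤ 0) (hγ : γ ≤ 0) : False := by
  subst h
  simp only [map_add, map_smul, smul_eq_mul] at hd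
  obtain rfl : α = 1 - β - γ := by linarith
  nlinarith [mul_nonneg (neg_nonneg.2 hβ) (sub_pos.2 hb).le,
    mul_nonneg (neg_nonneg.2 hγ) (sub_pos.2 hc).le]

theorem isOpposite_trichotomy {V : Set (ℝ × ℝ)} {a b c d : ℝ × ℝ} (ha : IsVertex V a)
    (hb : IsVertex V b) (hc : IsVertex V c) (hd : d ∈ V) (hab : a ≠ b) (hac : a ≠ c)
    (hbc : b ≠ c) (hda : d ≠ a) (hdb : d ≠ b) (hdc : d ≠ c) (hx : a.1 ≠ b.1)
    (hcol : ¬ Collinear ℝ ({a, b, c} : Set (ℝ × ℝ))) (F : ℝ × ℝ →ₗ[ℝ] ℝ) {k : ℝ}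
    (hFa : F a ≤ k) (hFb : F b ≤ k) (hFc : F c ≤ k) (hFd : k < F d) :
    IsOpposite a b c d ∨ IsOpposite b a c d ∨ IsOpposite c a b d := by
  obtain ⟨α, β, γ, hs, h⟩ := exists_barycentric hx hcol d
  obtain ⟨haV, A, hA⟩ := ha
  obtain ⟨hbV, B, hB⟩ := hb
  obtain ⟨hcV, C, hC⟩ := hc
  have h1 : ¬ (β ≤ 0 ∧ γ ≤ 0) := fun h' =>
    not_barycentric_of_minimizer A (hA b hbV hab.symm) (hA c hcV hac.symm) (hA d hd hda) hs h
      h'.1 h'.2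
  have h2 : ¬ (α ≤ 0 ∧ γ ≤ 0) := fun h' =>
    not_barycentric_of_minimizer B (α := β) (β := α) (hB a haV hab) (hB c hcV hbc.symm)
      (hB d hd hdb) (by linarith) (by rw [h]; abel) h'.1 h'.2
  have h3 : ¬ (α ≤ 0 ∧ β ≤ 0) := fun h' =>
    not_barycentric_of_minimizer C (α := γ) (β := α) (γ := β) (hC a haV hac) (hC b hbV hbc)
      (hC d hd hdc) (by linarith) (by rw [h]; abel) h'.1 h'.2
  have h4 : ¬ (0 ≤ α ∧ 0 ≤ β ∧ 0 ≤ γ) := by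
    rintro ⟨hα, hβ, hγ⟩
    rw [h] at hFd
    simp only [map_add, map_smul, smul_eq_mul] at hFd
    obtain rfl : α = 1 - β - γ := by linarith
    nlinarith [mul_nonneg hα (sub_nonneg.2 hFa), mul_nonneg hβ (sub_nonneg.2 hFb),
      mul_nonneg hγ (sub_nonneg.2 hFc)]
  rcases lt_or_ge α 0 with hα | hα
  · exact .inl ⟨α, β, γ, hs, hα, by grind, by grind, h⟩
  rcases lt_or_ge β 0 with hβ | hβ
  · exact .inr (.inl ⟨β, α, γ, by linarith, hβ, hα, by grind, by rw [h]; abel⟩)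
  · exact .inr (.inr ⟨γ, α, β, by linarith, by grind, hα, hβ, by rw [h]; abel⟩)

theorem exists_injOn_refinement {V : Set (ℝ × ℝ)} (hfin : V.Finite)
    (hx : ∀ p ∈ V, ∀ q ∈ V, p ≠ q → p.1 ≠ q.1) (F : ℝ × ℝ →ₗ[ℝ] ℝ) :
    ∃ G : ℝ × ℝ →ₗ[ℝ] ℝ, Set.InjOn G V ∧ ∀ p ∈ V, ∀ q ∈ V, F p < F q → G p < G q := by
  have key : ∀ᶠ ε : ℝ in nhdsWithin 0 (Set.Ioi 0), ∀ p ∈ V, ∀ q ∈ V, F p < F q →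
      F p + ε * p.1 < F q + ε * q.1 := by
    apply Filter.Eventually.filter_mono nhdsWithin_le_nhds
    rw [Filter.eventually_all_finite hfin]
    intro p _
    rw [Filter.eventually_all_finite hfin]
    intro q _
    rw [Filter.eventually_imp_distrib_left]
    intro hpq
    have h1 : Continuous fun ε : ℝ => F p + ε * p.1 := by fun_prop
    have h2 : Continuous fun ε : ℝ => F q + ε * q.1 := by fun_prop
    exact h1.continuousAt.eventually_lt h2.continuousAt (by simpa using hpq)
  obtain ⟨ε, hε, hpos⟩ := (key.and self_mem_nhdsWithin).exists
  have hpos : 0 < ε := hpos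
  refine ⟨F + ε • LinearMap.fst ℝ ℝ ℝ, ?_, fun p hp q hq h => by simpa using hε p hp q hq h⟩
  intro p hp q hq h
  simp only [LinearMap.add_apply, LinearMap.smul_apply, LinearMap.fst_apply, smul_eq_mul] at h
  rcases lt_trichotomy (F p) (F q) with hF | hF | hF
  · exact absurd h (hε p hp q hq hF).ne
  · by_contra hpq
    rw [hF, add_right_inj] at h
    exact hx p hp q hq hpq (mul_left_cancel₀ hpos.ne' h)
  · exact absurd h (hε q hq p hp hF).ne'

theorem IsSeparableTriple.exists_isVertex {V : Set (ℝ × ℝ)} (hfin : V.Finite)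
    (hx : ∀ p ∈ V, ∀ q ∈ V, p ≠ q → p.1 ≠ q.1) {T : Finset (ℝ × ℝ)}
    (hT : IsSeparableTriple V T) : ∃ p ∈ T, IsVertex V p := by
  obtain ⟨hTV, hcard, F, k, hle, hlt⟩ := hT
  obtain ⟨t, ht⟩ : T.Nonempty := Finset.card_pos.1 (by omega)
  obtain ⟨G, hinj, hG⟩ := exists_injOn_refinement hfin hx F
  obtain ⟨p, hp, hmin⟩ := hfin.exists_minimalFor G V ⟨t, hTV ht⟩
  have hmin' : ∀ q ∈ V, G p ≤ G q := fun q hq =>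
    (le_total (G p) (G q)).elim id (fun h => hmin hq h)
  refine ⟨p, ?_, hp, G, fun q hq hqp => (hmin' q hq).lt_of_ne fun h => hqp (hinj hp hq h).symm⟩
  by_contra hpT
  exact (hG t (hTV ht) p hp ((hle t ht).trans_lt (hlt p hp hpT))).not_ge (hmin' t (hTV ht))

theorem exists_initial_finset {α : Type*} (S : Finset α) {G : α → ℝ}
    (hG : Set.InjOn G S) (n : ℕ) (hn : n ≤ S.card) :
    ∃ T ⊆ S, T.card = n ∧ ∀ x ∈ T, ∀ y ∈ S, y ∉ T → G x < G y := by
  classical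
  induction n with
  | zero => exact ⟨∅, by simp⟩
  | succ n ih =>
    obtain ⟨T, hTS, hcard, hT⟩ := ih (by omega)
    have hne : (S \ T).Nonempty := by
      rw [← Finset.card_pos, Finset.card_sdiff_of_subset hTS]
      omega
    obtain ⟨q, hq, hmin⟩ := Finset.exists_min_image (S \ T) G hne
    rw [Finset.mem_sdiff] at hq
    refine ⟨insert q T, Finset.insert_subset hq.1 hTS, by rw [Finset.card_insert_of_notMem hq.2,
      hcard], ?_⟩
    intro x hx y hy hyT
    rw [Finset.mem_insert, not_or] at hyT
    rcases Finset.mem_insert.1 hx with rfl | hx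
    · exact (hmin y (Finset.mem_sdiff.2 ⟨hy, hyT.2⟩)).lt_of_ne
        fun h => hyT.1 (hG hq.1 hy h).symm
    · exact hT x hx y hy hyT.2

theorem exists_isSeparableTriple_subset {V : Set (ℝ × ℝ)} (hfin : V.Finite)
    (hx : ∀ p ∈ V, ∀ q ∈ V, p ≠ q → p.1 ≠ q.1) {h : Set (ℝ × ℝ)} (hh : IsHalfPlane h)
    (hcard : 3 ≤ (h ∩ V).ncard) :
    ∃ T : Finset (ℝ × ℝ), IsSeparableTriple V T ∧ (T : Set (ℝ × ℝ)) ⊆ h ∩ V := by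
  obtain ⟨a, b, k, -, rfl⟩ := hh
  obtain ⟨G, hinj, hG⟩ := exists_injOn_refinement hfin hx
    (a • LinearMap.fst ℝ ℝ ℝ + b • LinearMap.snd ℝ ℝ ℝ)
  simp only [LinearMap.add_apply, LinearMap.smul_apply, LinearMap.fst_apply,
    LinearMap.snd_apply, smul_eq_mul] at hG
  obtain ⟨T, hTV, hT3, hT⟩ := exists_initial_finset hfin.toFinset (G := G) (by simpa using hinj) 3
    (by
      rw [← Set.ncard_eq_toFinset_card V hfin]
      exact hcard.trans (Set.ncard_le_ncard Set.inter_subset_right hfin))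
  have hTV' : ∀ p ∈ T, p ∈ V := fun p hp => hfin.mem_toFinset.1 (hTV hp)
  obtain ⟨m, hm, hmax⟩ := Finset.exists_max_image T G (Finset.card_pos.1 (by omega))
  refine ⟨T, ⟨hTV', hT3, G, G m, hmax,
    fun p hp hpT => hT m hm p (hfin.mem_toFinset.2 hp) hpT⟩, fun t ht => ⟨?_, hTV' t ht⟩⟩
  by_contra hth
  obtain ⟨s, hs, hsT⟩ : ∃ s ∈ {p : ℝ × ℝ | a * p.1 + b * p.2 ≤ k} ∩ V, s ∉ T.erase t := by
    by_contra! hsub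
    have h1 := Set.ncard_le_ncard (t := (T.erase t : Set (ℝ × ℝ))) hsub (Finset.finite_toSet _)
    rw [Set.ncard_coe_finset, Finset.card_erase_of_mem ht] at h1
    omega
  have hst : G s < G t := hG s hs.2 t (hTV' t ht) (lt_of_le_of_lt hs.1 (not_le.1 hth))
  have hsT' : s ∉ T := fun h' => hsT (Finset.mem_erase.2 ⟨fun e => hst.ne (by rw [e]), h'⟩)
  exact (hT t ht s (hfin.mem_toFinset.2 hs.2) hsT').not_gt hst

/-- Three vertices forming a separable triple cannot each be cut off, together with a further point,
from the other two. -/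
theorem IsSeparableTriple.not_all_critical {V : Set (ℝ × ℝ)} {T : Finset (ℝ × ℝ)}
    (hx : ∀ p ∈ V, ∀ q ∈ V, p ≠ q → p.1 ≠ q.1)
    (hgen : ∀ p ∈ V, ∀ q ∈ V, ∀ r ∈ V, p ≠ q → q ≠ r → p ≠ r →
      ¬ Collinear ℝ ({p, q, r} : Set (ℝ × ℝ)))
    (hT : IsSeparableTriple V T) (hvert : ∀ p ∈ T, IsVertex V p)
    (hcrit : ∀ p ∈ T, ∃ d ∈ V, d ∉ T ∧ ∃ (G : ℝ × ℝ →ₗ[ℝ] ℝ) (l : ℝ), G p ≤ l ∧ G d ≤ l ∧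
      ∀ q ∈ T, q ≠ p → l < G q) : False := by
  obtain ⟨hTV, hcard, F, k, hle, hlt⟩ := hT
  obtain ⟨a, b, c, hab, hac, hbc, rfl⟩ := Finset.card_eq_three.1 hcard
  have ha := hvert a (by simp)
  have hb := hvert b (by simp)
  have hc := hvert c (by simp)
  have hFa := hle a (by simp)
  have hFb := hle b (by simp)
  have hFc := hle c (by simp)
  obtain ⟨d₁, hd₁, hn₁, G₁, l₁, hp₁, hq₁, hr₁⟩ := hcrit a (by simp)
  obtain ⟨d₂, hd₂, hn₂, G₂, l₂, hp₂, hq₂, hr₂⟩ := hcrit b (by simp)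
  obtain ⟨d₃, hd₃, hn₃, G₃, l₃, hp₃, hq₃, hr₃⟩ := hcrit c (by simp)
  have htri : ∀ d ∈ V, d ∉ ({a, b, c} : Finset (ℝ × ℝ)) →
      IsOpposite a b c d ∨ IsOpposite b a c d ∨ IsOpposite c a b d := by
    intro d hd hdT
    have hdT' := hdT
    simp only [Finset.mem_insert, Finset.mem_singleton, not_or] at hdT'
    exact isOpposite_trichotomy ha hb hc hd hab hac hbc hdT'.1 hdT'.2.1 hdT'.2.2
      (hx a ha.1 b hb.1 hab) (hgen a ha.1 b hb.1 c hc.1 hab hbc hac) F hFa hFb hFc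
      (hlt d hd hdT)
  have hna : ¬ IsOpposite a b c d₁ := fun h =>
    h.not_separated G₁ hp₁ hq₁ (hr₁ b (by simp) hab.symm) (hr₁ c (by simp) hac.symm)
  have hnb : ¬ IsOpposite b a c d₂ := fun h =>
    h.not_separated G₂ hp₂ hq₂ (hr₂ a (by simp) hab) (hr₂ c (by simp) hbc.symm)
  have hnc : ¬ IsOpposite c a b d₃ := fun h =>
    h.not_separated G₃ hp₃ hq₃ (hr₃ a (by simp) hac) (hr₃ b (by simp) hbc)
  have hexcl : ∀ x y z d d', x ∈ ({a, b, c} : Finset (ℝ × ℝ)) →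
      y ∈ ({a, b, c} : Finset (ℝ × ℝ)) → z ∈ ({a, b, c} : Finset (ℝ × ℝ)) → y ≠ x → d ∈ V →
      d ∉ ({a, b, c} : Finset (ℝ × ℝ)) → d' ∈ V → d' ∉ ({a, b, c} : Finset (ℝ × ℝ)) →
      IsOpposite y x z d → IsOpposite z x y d' → False := by
    intro x y z d d' hxT hyT hzT hyx hd hdT hd' hdT' h h'
    obtain ⟨-, E, hE⟩ := hvert x hxT
    exact not_isOpposite_of_isOpposite h h' F (hle x hxT) (hle y hyT) (hle z hzT)
      (hlt d hd hdT) (hlt d' hd' hdT') E (hE y (hTV hyT) hyx)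
      (hE d hd fun e => hdT (e ▸ hxT)) (hE d' hd' fun e => hdT' (e ▸ hxT))
  have hbc' : ∀ d ∈ V, d ∉ ({a, b, c} : Finset (ℝ × ℝ)) → ∀ d' ∈ V,
      d' ∉ ({a, b, c} : Finset (ℝ × ℝ)) → IsOpposite b a c d → IsOpposite c a b d' → False :=
    fun d hd hdT d' hd' hdT' h h' =>
      hexcl a b c d d' (by simp) (by simp) (by simp) hab.symm hd hdT hd' hdT' h h'
  have hac' : ∀ d ∈ V, d ∉ ({a, b, c} : Finset (ℝ × ℝ)) → ∀ d' ∈ V,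
      d' ∉ ({a, b, c} : Finset (ℝ × ℝ)) → IsOpposite a b c d → IsOpposite c a b d' → False :=
    fun d hd hdT d' hd' hdT' h h' =>
      hexcl b a c d d' (by simp) (by simp) (by simp) hab hd hdT hd' hdT' h h'.swap
  have hab' : ∀ d ∈ V, d ∉ ({a, b, c} : Finset (ℝ × ℝ)) → ∀ d' ∈ V,
      d' ∉ ({a, b, c} : Finset (ℝ × ℝ)) → IsOpposite a b c d → IsOpposite b a c d' → False :=
    fun d hd hdT d' hd' hdT' h h' =>
      hexcl c a b d d' (by simp) (by simp) (by simp) hac hd hdT hd' hdT' h.swap h'.swap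
  rcases htri d₁ hd₁ hn₁ with h₁ | h₁ | h₁
  · exact hna h₁
  · rcases htri d₂ hd₂ hn₂ with h₂ | h₂ | h₂
    · exact hab' d₂ hd₂ hn₂ d₁ hd₁ hn₁ h₂ h₁
    · exact hnb h₂
    · exact hbc' d₁ hd₁ hn₁ d₂ hd₂ hn₂ h₁ h₂
  · rcases htri d₃ hd₃ hn₃ with h₃ | h₃ | h₃
    · exact hac' d₃ hd₃ hn₃ d₁ hd₁ hn₁ h₃ h₁
    · exact hbc' d₃ hd₃ hn₃ d₁ hd₁ hn₁ h₃ h₁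
    · exact hnc h₃

/-- Some set of points meets every separable triple without containing any of them. -/
theorem exists_splitting_finset {V : Set (ℝ × ℝ)} (hfin : V.Finite)
    (hx : ∀ p ∈ V, ∀ q ∈ V, p ≠ q → p.1 ≠ q.1)
    (hgen : ∀ p ∈ V, ∀ q ∈ V, ∀ r ∈ V, p ≠ q → q ≠ r → p ≠ r →
      ¬ Collinear ℝ ({p, q, r} : Set (ℝ × ℝ))) :
    ∃ R : Finset (ℝ × ℝ), ∀ T, IsSeparableTriple V T →
      (∃ p ∈ T, p ∈ R) ∧ ∃ p ∈ T, p ∉ R := by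
  classical
  obtain ⟨R, hRle, hR⟩ := exists_minimal_le_of_wellFoundedLT
    (fun R : Finset (ℝ × ℝ) => ∀ T, IsSeparableTriple V T → ∃ p ∈ T, p ∈ R)
    (hfin.toFinset.filter (IsVertex V)) (by
      intro T hT
      obtain ⟨p, hp, hpv⟩ := hT.exists_isVertex hfin hx
      exact ⟨p, hp, by simp [hpv, hpv.1]⟩)
  refine ⟨R, fun T hT => ⟨hR.prop T hT, ?_⟩⟩
  by_contra! hTR
  refine hT.not_all_critical hx hgen (fun p hp => (Finset.mem_filter.1 (hRle (hTR p hp))).2) ?_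
  intro p hp
  have hnot := hR.not_prop_of_lt (Finset.erase_ssubset (hTR p hp))
  push Not at hnot
  obtain ⟨S, hS, hSR⟩ := hnot
  have hSR' : ∀ q ∈ S, q ≠ p → q ∉ R := fun q hq hqp hqR =>
    hSR q hq (Finset.mem_erase.2 ⟨hqp, hqR⟩)
  obtain ⟨q, hq, hqR⟩ := hR.prop S hS
  obtain rfl : q = p := by
    by_contra hqp
    exact hSR' q hq hqp hqR
  obtain ⟨hSV, hcard, G, l, hle, hlt⟩ := hS
  obtain ⟨d, hd, hdq⟩ := Finset.exists_mem_ne (s := S) (by omega) q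
  refine ⟨d, hSV hd, fun h => hSR' d hd hdq (hTR d h), G, l, hle q hq, hle d hd, ?_⟩
  exact fun r hr hrq => hlt r (hT.1 hr) fun h => hSR' r h hrq (hTR r hr)

/-- Any finite planar point set in general position can be 2-colored so that
every closed half-plane containing at least three of the points contains points
of both colors. -/
theorem points_halfplane_coloring
    (V : Set (ℝ × ℝ)) (hfin : V.Finite)
    (hx : ∀ p ∈ V, ∀ q ∈ V, p ≠ q → p.1 ≠ q.1)
    (hgen : ∀ p ∈ V, ∀ q ∈ V, ∀ r ∈ V, p ≠ q → q ≠ r → p ≠ r →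
      ¬ Collinear ℝ ({p, q, r} : Set (ℝ × ℝ))) :
    ∃ χ : ℝ × ℝ → Bool,
      ∀ h : Set (ℝ × ℝ), IsHalfPlane h → 3 ≤ (h ∩ V).ncard →
        (∃ p ∈ h ∩ V, χ p = true) ∧ (∃ p ∈ h ∩ V, χ p = false) := by
  classical
  obtain ⟨R, hR⟩ := exists_splitting_finset hfin hx hgen
  refine ⟨fun p => decide (p ∈ R), fun h hh hcard => ?_⟩
  obtain ⟨T, hT, hTh⟩ := exists_isSeparableTriple_subset hfin hx hh hcard
  obtain ⟨⟨p, hp, hpR⟩, q, hq, hqR⟩ := hR T hT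
  exact ⟨⟨p, hTh hp, by simpa using hpR⟩, q, hTh hq, by simpa using hqR⟩
end
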